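/- Let c(n) = 4^{n+1}(n+1)^{(n+1)/2}(n+1)! and let θ = (θ₀,…,θₙ) with all θᵢ > 0. Then for any discrete subgroup Γ of ℝ^{n+1} such that ℓ = rank(Γ ∩ Π_θ) > 0, one has #(Γ ∩ Π_θ) ≤ c(n) · Θ_ℓ / δ(Γ)^ℓ + n + 1, where Θ_ℓ = max over subsets I ⊆ {0,…,n} of cardinality ℓ of ∏_{i ∈ I} θᵢ. -/

import Mathlib

open MeasureTheory ENNReal

/-- `δ(Γ) = inf {‖a‖_∞ : a ∈ Γ, a ≠ 0}` as a real number; the norm on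
`Fin d → ℝ` is the sup norm. -/
noncomputable def latDeltaR {d : ℕ} (Γ : Set (Fin d → ℝ)) : ℝ :=
  sInf {t | ∃ a ∈ Γ, a ≠ 0 ∧ t = ‖a‖}

/-- The open box `Π_θ = {x : |xᵢ| < θᵢ for all i}`. -/
def PiBox {d : ℕ} (θ : Fin d → ℝ) : Set (Fin d → ℝ) := {x | ∀ i, |x i| < θ i}

/-- The constant `c(n) = 4^{n+1} (n+1)^{(n+1)/2} (n+1)!`. -/
noncomputable def cConst (n : ℕ) : ℝ :=
  4 ^ (n + 1) * ((n : ℝ) + 1) ^ (((n : ℝ) + 1) / 2) * (Nat.factorial (n + 1) : ℝ)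

section AuxLemmas

open scoped Pointwise

lemma aux_basis {m : ℕ} (G : Matrix (Fin m) (Fin m) ℝ) (hG : G.det ≠ 0) :
    ∃ b : Module.Basis (Fin m) ℝ (Fin m → ℝ), ∀ j, b j = G j := by
  have hli : LinearIndependent ℝ G.row := Matrix.linearIndependent_rows_of_det_ne_zero hG
  refine ⟨basisOfLinearIndependentOfCardEqFinrank' _ hli (by simp), fun j => ?_⟩
  simp
  rfl

lemma aux_vol {m : ℕ} (G : Matrix (Fin m) (Fin m) ℝ)
    (b : Module.Basis (Fin m) ℝ (Fin m → ℝ)) (hb : ∀ j, b j = G j) :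
    volume (ZSpan.fundamentalDomain b) = ENNReal.ofReal |G.det| := by
  rw [ZSpan.volume_fundamentalDomain]
  congr 3
  ext i j
  simp [hb]

lemma aux_minkowski {m : ℕ} (G : Matrix (Fin m) (Fin m) ℝ) (hG : G.det ≠ 0) (c : ℝ) (hc : 0 < c)
    (h : ∀ z : Fin m → ℤ, z ≠ 0 → ∃ i, c ≤ |∑ j, (z j : ℝ) * G j i|) : c ^ m ≤ |G.det| := by
  obtain ⟨b, hb⟩ := aux_basis G hG
  by_contra! hlt
  have : Countable (Submodule.span ℤ (Set.range b)).toAddSubgroup :=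
    inferInstanceAs (Countable (Submodule.span ℤ (Set.range b)))
  have key := exists_ne_zero_mem_lattice_of_measure_mul_two_pow_lt_measure
    (s := Set.pi Set.univ fun _ : Fin m => Set.Ioo (-c) c)
    (ZSpan.isAddFundamentalDomain' b (volume : Measure (Fin m → ℝ)))
    (by
      intro x hx i hi
      have := hx i hi
      simp only [Set.mem_Ioo, Pi.neg_apply] at this ⊢
      constructor <;> linarith [this.1, this.2])
    (convex_pi fun i _ => convex_Ioo _ _)
    (by
      rw [aux_vol G b hb, Real.volume_pi_Ioo, Module.finrank_fintype_fun_eq_card, Fintype.card_fin]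
      simp only [sub_neg_eq_add, Finset.prod_const, Finset.card_univ, Fintype.card_fin]
      rw [← two_mul, ENNReal.ofReal_mul (by norm_num), mul_pow, ENNReal.ofReal_ofNat, mul_comm]
      refine (ENNReal.mul_lt_mul_iff_right (by simp) (by simp)).2 ?_
      rw [← ENNReal.ofReal_pow hc.le]
      exact (ENNReal.ofReal_lt_ofReal_iff (by positivity)).2 hlt)
  obtain ⟨⟨x, hx⟩, hx0, hxs⟩ := key
  have hx' : x ∈ Submodule.span ℤ (Set.range b) := hx
  obtain ⟨z, hz⟩ := (Submodule.mem_span_range_iff_exists_fun ℤ).1 hx'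
  have hz0 : z ≠ 0 := by
    rintro rfl
    apply hx0
    ext1
    simpa using hz.symm
  obtain ⟨i, hi⟩ := h z hz0
  have := hxs i (Set.mem_univ i)
  have e : x i = ∑ j, (z j : ℝ) * G j i := by
    rw [← hz]; simp [hb]
  simp only [Set.mem_Ioo] at this
  rw [e] at this
  exact absurd (abs_lt.2 this) (not_lt.2 hi)

lemma aux_translates {E L : Type*} [AddGroup L] [Countable L] [AddAction L E] [MeasurableSpace E]
    [MeasurableSpace L] [MeasurableVAdd L E] (μ : Measure E) [VAddInvariantMeasure L E μ]
    {F T : Set E} (fund : IsAddFundamentalDomain L F μ) (hT : MeasurableSet T)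
    (k : ℕ) (h : ∀ x : E, ∃ A : Finset L, k ≤ A.card ∧ ∀ g ∈ A, x ∈ g +ᵥ T) :
    k * μ F ≤ μ T := by
  rw [fund.measure_eq_tsum T]
  have hm : ∀ g : L, MeasurableSet (g +ᵥ T) := fun g => hT.const_vadd g
  calc (k : ℝ≥0∞) * μ F = ∫⁻ x in F, (k : ℝ≥0∞) ∂μ := by simp
    _ ≤ ∫⁻ x in F, ∑' g : L, (g +ᵥ T).indicator 1 x ∂μ := by
      refine lintegral_mono fun x => ?_
      obtain ⟨A, hA, hx⟩ := h x
      calc (k : ℝ≥0∞) ≤ (A.card : ℝ≥0∞) := by exact_mod_cast hA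
        _ = ∑ g ∈ A, (g +ᵥ T).indicator (1 : E → ℝ≥0∞) x := by
          rw [Finset.sum_congr rfl (fun g hg => Set.indicator_of_mem (hx g hg) _)]
          simp
        _ ≤ _ := ENNReal.sum_le_tsum A
    _ = ∑' g : L, ∫⁻ x in F, (g +ᵥ T).indicator 1 x ∂μ :=
      lintegral_tsum fun g => (measurable_one.indicator (hm g)).aemeasurable
    _ = _ := by
      congr 1; ext g
      rw [lintegral_indicator_one (hm g), Measure.restrict_apply (hm g)]

lemma aux_count {m : ℕ} (G : Matrix (Fin m) (Fin m) ℝ) (hG : G.det ≠ 0) (θ : Fin m → ℝ)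
    (hθ : ∀ i, 0 < θ i)
    (v : Fin m → Fin m → ℝ) (hv : LinearIndependent ℝ v)
    (hvL : ∀ k, v k ∈ Submodule.span ℤ (Set.range fun j => G j)) (hvθ : ∀ k i, |v k i| < θ i)
    (S : Finset (Fin m → ℝ)) (hSL : ∀ x ∈ S, x ∈ Submodule.span ℤ (Set.range fun j => G j))
    (hSθ : ∀ x ∈ S, ∀ i, |x i| < θ i) :
    S.card * |G.det| ≤ (m + 2 : ℝ) ^ m * ∏ i, θ i := by
  classical
  obtain ⟨b, hb⟩ := aux_basis G hG
  have hbr : (Set.range fun j => G j) = Set.range b := by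
    congr 1; ext1 j; exact (hb j).symm
  rw [hbr] at hvL hSL
  let w := basisOfLinearIndependentOfCardEqFinrank' _ hv (by simp)
  have hw : ∀ k, w k = v k := fun k => by simp [w]
  let T : Set (Fin m → ℝ) := Set.pi Set.univ fun i =>
    Set.Ioo (-((m / 2 + 1 : ℝ) * θ i)) ((m / 2 + 1 : ℝ) * θ i)
  have hT : MeasurableSet T := MeasurableSet.univ_pi fun i => measurableSet_Ioo
  have : Countable (Submodule.span ℤ (Set.range b)).toAddSubgroup :=
    inferInstanceAs (Countable (Submodule.span ℤ (Set.range b)))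
  have key := aux_translates volume
    (ZSpan.isAddFundamentalDomain' b (volume : Measure (Fin m → ℝ))) hT S.card (by
      intro x
      -- reduce x
      let u : Fin m → ℝ := ∑ k, round (w.repr x k) • v k
      have hu : u ∈ Submodule.span ℤ (Set.range b) :=
        Submodule.sum_mem _ fun k _ => Submodule.smul_mem _ _ (hvL k)
      have hy : ∀ i, |(x - u) i| ≤ m / 2 * θ i := by
        intro i
        have e : (x - u) i = ∑ k, (w.repr x k - round (w.repr x k)) * v k i := by
          have h1 := congrFun (w.sum_repr x) i
          simp only [Finset.sum_apply, Pi.smul_apply, smul_eq_mul, hw] at h1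
          simp only [Pi.sub_apply, u, Finset.sum_apply, sub_mul, Finset.sum_sub_distrib, h1]
          simp
        rw [e]
        refine (Finset.abs_sum_le_sum_abs _ _).trans ?_
        have : ∀ k ∈ (Finset.univ : Finset (Fin m)),
            |(w.repr x k - round (w.repr x k)) * v k i| ≤ 1 / 2 * θ i := by
          intro k _
          rw [abs_mul]
          exact mul_le_mul (abs_sub_round _) (hvθ k i).le (abs_nonneg _) (by norm_num)
        refine (Finset.sum_le_sum this).trans (le_of_eq ?_)
        simp; ring
      let φ : S → (Submodule.span ℤ (Set.range b)).toAddSubgroup := fun s =>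
        ⟨u - s.1, Submodule.sub_mem _ hu (hSL s.1 s.2)⟩
      have hφ : Function.Injective φ := by
        intro s t hst
        have : u - s.1 = u - t.1 := congrArg Subtype.val hst
        exact Subtype.ext (sub_right_injective this)
      refine ⟨Finset.univ.map ⟨φ, hφ⟩, by simp, ?_⟩
      intro g hg
      obtain ⟨s, -, rfl⟩ := Finset.mem_map.1 hg
      rw [Set.mem_vadd_set_iff_neg_vadd_mem]
      intro i _
      have e : (-(φ s) +ᵥ x) i = (x - u) i + s.1 i := by
        change (-(u - s.1) + x) i = _
        simp; ring
      change (-(φ s) +ᵥ x) i ∈ _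
      rw [e]
      have h1 := hy i
      have h2 := hSθ s.1 s.2 i
      have h3 := abs_add_le ((x - u) i) (s.1 i)
      refine abs_lt.1 ?_
      linarith)
  rw [aux_vol G b hb, Real.volume_pi_Ioo] at key
  have hnn : ∀ i, 0 ≤ (m / 2 + 1 : ℝ) * θ i := fun i => by have := hθ i; positivity
  rw [← ENNReal.ofReal_prod_of_nonneg (fun i _ => by linarith [hnn i]),
    ← ENNReal.ofReal_natCast, ← ENNReal.ofReal_mul (by positivity),
    ENNReal.ofReal_le_ofReal_iff (Finset.prod_nonneg fun i _ => by linarith [hnn i])] at key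
  refine key.trans (le_of_eq ?_)
  have : ∀ i, (m / 2 + 1 : ℝ) * θ i - -((m / 2 + 1 : ℝ) * θ i) = (m + 2) * θ i := fun i => by ring
  simp only [this, Finset.prod_mul_distrib]
  simp

/-- Cauchy–Binet, ordered form. -/
lemma aux_cb {m N : ℕ} (B : Matrix (Fin m) (Fin N) ℝ) :
    ∑ f : Fin m → Fin N, (B.submatrix id f).det ^ 2 = (m.factorial : ℝ) * (B * B.transpose).det := by
  have h1 : (B * B.transpose).det =
      ∑ f : Fin m → Fin N, (∏ i, B i (f i)) * (B.submatrix id f).det := by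
    have h := (Matrix.detRowAlternating (n := Fin m) (R := ℝ)).toMultilinearMap.map_sum
      (fun (i : Fin m) (k : Fin N) => (B i k • (fun j => B j k) : Fin m → ℝ))
    have e : (B * B.transpose) = fun i => ∑ k, (B i k • (fun j => B j k) : Fin m → ℝ) := by
      ext i j
      simp [Matrix.mul_apply]
    change Matrix.detRowAlternating (B * B.transpose) = _
    rw [e]
    refine h.trans (Finset.sum_congr rfl fun f _ => ?_)
    rw [MultilinearMap.map_smul_univ, smul_eq_mul]
    congr 1
    rw [← Matrix.det_transpose]
    rfl
  have h2 : ∀ f : Fin m → Fin N, (B.submatrix id f).det ^ 2 =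
      ∑ σ : Equiv.Perm (Fin m), (∏ i, B i (f (σ i))) * (B.submatrix id (f ∘ σ)).det := by
    intro f
    have e : ∀ σ : Equiv.Perm (Fin m), (B.submatrix id (f ∘ σ)).det =
        (Equiv.Perm.sign σ : ℝ) * (B.submatrix id f).det := by
      intro σ
      rw [← Matrix.det_permute' σ]
      rfl
    rw [pow_two]
    nth_rewrite 1 [← Matrix.det_transpose, Matrix.det_apply']
    rw [Finset.sum_mul]
    refine Finset.sum_congr rfl fun σ _ => ?_
    rw [e]
    simp
    ring
  simp_rw [h2]
  rw [Finset.sum_comm, h1]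
  have : ∀ σ : Equiv.Perm (Fin m), ∑ f : Fin m → Fin N,
      (∏ i, B i (f (σ i))) * (B.submatrix id (f ∘ σ)).det =
      ∑ f : Fin m → Fin N, (∏ i, B i (f i)) * (B.submatrix id f).det := by
    intro σ
    exact Equiv.sum_comp (Equiv.arrowCongr σ.symm (Equiv.refl (Fin N)))
      (fun f => (∏ i, B i (f i)) * (B.submatrix id f).det)
  simp_rw [this]
  simp [Fintype.card_perm]

lemma aux_minor {m N : ℕ} (B : Matrix (Fin m) (Fin N) ℝ) (hB : 0 < (B * B.transpose).det) :
    ∃ f : Fin m → Fin N, Function.Injective f ∧ (B.submatrix id f).det ≠ 0 ∧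
      (B * B.transpose).det ≤ (N.choose m : ℝ) * (B.submatrix id f).det ^ 2 := by
  classical
  by_contra! hcon
  have hcb := aux_cb B
  have hz : ∀ f : Fin m → Fin N, ¬ Function.Injective f → (B.submatrix id f).det ^ 2 = 0 := by
    intro f hf
    obtain ⟨i, j, hij, hne⟩ : ∃ i j, f i = f j ∧ i ≠ j := by
      simpa [Function.Injective] using hf
    rw [Matrix.det_zero_of_column_eq hne (fun k => by simp [hij])]
    simp
  rw [← Finset.sum_filter_add_sum_filter_not Finset.univ (fun f => Function.Injective f)] at hcb
  rw [Finset.sum_eq_zero (s := Finset.univ.filter fun f => ¬ Function.Injective f)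
    (fun f hf => hz f (Finset.mem_filter.1 hf).2), add_zero] at hcb
  set D := (B * B.transpose).det
  have hcard : (Finset.univ.filter fun f : Fin m → Fin N => Function.Injective f).card
      = N.descFactorial m := by
    rw [← Fintype.card_subtype]
    rw [Fintype.card_congr (Equiv.subtypeInjectiveEquivEmbedding (Fin m) (Fin N)),
      Fintype.card_embedding_eq]
    simp
  have hlt : ∀ f ∈ (Finset.univ.filter fun f : Fin m → Fin N => Function.Injective f),
      (N.choose m : ℝ) * (B.submatrix id f).det ^ 2 < D := by
    intro f hf
    by_cases h0 : (B.submatrix id f).det = 0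
    · rw [h0]; simpa using hB
    · exact hcon f (Finset.mem_filter.1 hf).2 h0
  have hne : (Finset.univ.filter fun f : Fin m → Fin N => Function.Injective f).Nonempty := by
    by_contra hne
    rw [Finset.not_nonempty_iff_eq_empty.1 hne] at hcb
    have : (0 : ℝ) < m.factorial * D := by positivity
    simp at hcb
    rcases hcb with h | h
    · exact (Nat.factorial_ne_zero m) h
    · exact hB.ne' h
  have h := Finset.sum_lt_sum_of_nonempty hne hlt
  rw [← Finset.mul_sum, hcb, Finset.sum_const, hcard, Nat.descFactorial_eq_factorial_mul_choose,
    nsmul_eq_mul] at h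
  push_cast at h
  linarith

lemma aux_num (m : ℕ) : ((m : ℝ) + 2) ^ m ≤ 4 ^ m * m.factorial := by
  by_cases hm : m < 6
  · interval_cases m <;> norm_num [Nat.factorial]
  · push Not at hm
    have h1 : ((m : ℝ) + 2) ^ m / m.factorial ≤ Real.exp (m + 2) :=
      Real.pow_div_factorial_le_exp _ (by positivity) m
    have h2 : Real.exp (m + 2) ≤ 4 ^ m := by
      obtain ⟨k, rfl⟩ := Nat.exists_eq_add_of_le hm
      have he := Real.exp_one_lt_d9
      have : Real.exp ((6 + k : ℕ) + 2 : ℝ) = Real.exp 1 ^ 8 * Real.exp 1 ^ k := by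
        rw [← pow_add, ← Real.exp_nat_mul]; congr 1; push_cast; ring
      rw [this, pow_add]
      gcongr
      · calc Real.exp 1 ^ 8 ≤ (2.7182818286 : ℝ) ^ 8 := by gcongr
          _ ≤ 4 ^ 6 := by norm_num
      · linarith
    rw [div_le_iff₀ (by positivity)] at h1
    exact h1.trans (by gcongr)

open scoped MatrixOrder Matrix.Norms.L2Operator in
lemma aux_sqrt {m : ℕ} (P : Matrix (Fin m) (Fin m) ℝ) (hP : P.PosSemidef) :
    ∃ G : Matrix (Fin m) (Fin m) ℝ, P = G * G.transpose := by
  obtain ⟨G, hG⟩ := CStarAlgebra.nonneg_iff_eq_star_mul_self.1 hP.nonneg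
  refine ⟨G.transpose, ?_⟩
  rw [hG, Matrix.star_eq_conjTranspose, Matrix.conjTranspose_eq_transpose_of_trivial,
    Matrix.transpose_transpose]

lemma aux_gram {m N : ℕ} (hm : 0 < m) (B : Matrix (Fin m) (Fin N) ℝ)
    (hB : LinearIndependent ℝ B.row)
    (δ : ℝ) (hδ : 0 < δ) (h : ∀ z : Fin m → ℤ, z ≠ 0 → δ ≤ ‖fun i => ∑ j, (z j : ℝ) * B j i‖) :
    0 < (B * B.transpose).det ∧ (δ / √m) ^ m ≤ √((B * B.transpose).det) := by
  have hpd : (B * B.transpose).PosDef := by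
    have := Matrix.PosDef.mul_conjTranspose_self B (Matrix.vecMul_injective_iff.2 hB)
    rwa [Matrix.conjTranspose_eq_transpose_of_trivial] at this
  refine ⟨hpd.det_pos, ?_⟩
  obtain ⟨G, hG⟩ := aux_sqrt _ hpd.posSemidef
  have hdet : (B * B.transpose).det = G.det ^ 2 := by
    rw [hG, Matrix.det_mul, Matrix.det_transpose, pow_two]
  have hG0 : G.det ≠ 0 := by
    intro h0
    have := hpd.det_pos
    rw [hdet, h0] at this
    simp at this
  rw [hdet, Real.sqrt_sq_eq_abs]
  have hm' : (0 : ℝ) < m := by exact_mod_cast hm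
  refine aux_minkowski G hG0 _ (by positivity) ?_
  intro z hz
  by_contra! hcon
  have hsq : ∀ {k : ℕ} (C : Matrix (Fin m) (Fin k) ℝ) (t : Fin m → ℝ),
      t ⬝ᵥ ((C * C.transpose).mulVec t) = ∑ i, (∑ j, t j * C j i) ^ 2 := by
    intro k C t
    rw [← Matrix.mulVec_mulVec, Matrix.dotProduct_mulVec, Matrix.mulVec_transpose]
    simp [dotProduct, Matrix.vecMul, pow_two]
  have e : ∑ i, (∑ j, (z j : ℝ) * B j i) ^ 2 = ∑ i, (∑ j, (z j : ℝ) * G j i) ^ 2 := by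
    rw [← hsq B (fun j => (z j : ℝ)), ← hsq G (fun j => (z j : ℝ)), hG]
  have hlt : ∑ i, (∑ j, (z j : ℝ) * G j i) ^ 2 < δ ^ 2 := by
    have : Nonempty (Fin m) := ⟨⟨0, hm⟩⟩
    calc ∑ i, (∑ j, (z j : ℝ) * G j i) ^ 2 < ∑ i : Fin m, (δ / √m) ^ 2 := by
          refine Finset.sum_lt_sum_of_nonempty Finset.univ_nonempty fun i _ => ?_
          rw [← sq_abs]
          exact pow_lt_pow_left₀ (hcon i) (abs_nonneg _) (by norm_num)
      _ = δ ^ 2 := by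
          simp [div_pow, Real.sq_sqrt hm'.le]
          field_simp
  have hle := h z hz
  have : ‖fun i => ∑ j, (z j : ℝ) * B j i‖ < δ := by
    rw [pi_norm_lt_iff hδ]
    intro i
    rw [Real.norm_eq_abs]
    refine abs_lt_of_sq_lt_sq ?_ hδ.le
    rw [← e] at hlt
    exact lt_of_le_of_lt (Finset.single_le_sum
      (f := fun i => (∑ j, (z j : ℝ) * B j i) ^ 2) (fun i _ => sq_nonneg _) (Finset.mem_univ i)) hlt
  linarith

lemma aux_const (n ℓ : ℕ) (hle : ℓ ≤ n + 1) :
    ((ℓ : ℝ) + 2) ^ ℓ * √((n + 1).choose ℓ) * √ℓ ^ ℓ ≤ cConst n := by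
  unfold cConst
  have h1 := aux_num ℓ
  have hch : (1 : ℝ) ≤ (n + 1).choose ℓ := by exact_mod_cast Nat.choose_pos hle
  have h2 : √((n + 1).choose ℓ : ℝ) ≤ (n + 1).choose ℓ := by
    rw [Real.sqrt_le_left (by linarith)]
    nlinarith
  have h3 : (ℓ.factorial : ℝ) * (n + 1).choose ℓ ≤ (n + 1).factorial := by
    have := Nat.choose_mul_factorial_mul_factorial hle
    have h4 : ℓ.factorial * (n + 1).choose ℓ ≤ (n + 1).factorial := by
      rw [← this, mul_comm]
      exact Nat.le_mul_of_pos_right _ (Nat.factorial_pos _)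
    exact_mod_cast h4
  have h4 : √(ℓ : ℝ) ^ ℓ ≤ ((n : ℝ) + 1) ^ (((n : ℝ) + 1) / 2) := by
    have hl : (ℓ : ℝ) ≤ n + 1 := by exact_mod_cast hle
    rw [Real.sqrt_eq_rpow, ← Real.rpow_natCast, ← Real.rpow_mul (by positivity)]
    calc (ℓ : ℝ) ^ (1 / 2 * (ℓ : ℝ)) ≤ ((n : ℝ) + 1) ^ (1 / 2 * (ℓ : ℝ)) :=
          Real.rpow_le_rpow (by positivity) hl (by positivity)
      _ ≤ _ := Real.rpow_le_rpow_of_exponent_le (by linarith [(Nat.cast_nonneg n : (0:ℝ) ≤ n)])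
          (by linarith)
  calc ((ℓ : ℝ) + 2) ^ ℓ * √((n + 1).choose ℓ) * √ℓ ^ ℓ
      ≤ (4 ^ ℓ * ℓ.factorial) * (n + 1).choose ℓ * ((n : ℝ) + 1) ^ (((n : ℝ) + 1) / 2) := by gcongr
    _ = 4 ^ ℓ * ((n : ℝ) + 1) ^ (((n : ℝ) + 1) / 2) * (ℓ.factorial * (n + 1).choose ℓ) := by ring
    _ ≤ _ := by
      gcongr
      norm_num

lemma aux_discrete {N : ℕ} (L : AddSubgroup (Fin N → ℝ))
    (h : ∃ ε > 0, ∀ x ∈ L, x ≠ 0 → ε ≤ ‖x‖) : DiscreteTopology L := by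
  obtain ⟨ε, hε, h⟩ := h
  refine DiscreteTopology.of_forall_le_norm hε ?_
  intro x hx
  exact h x x.2 (by simpa using hx)

lemma aux_lattice {N m : ℕ} (s : Set (Fin N → ℝ)) (hd : DiscreteTopology (Submodule.span ℤ s))
    (hm : m = Module.finrank ℝ (Submodule.span ℝ s)) :
    ∃ b : Fin m → Fin N → ℝ, LinearIndependent ℝ b ∧
      Submodule.span ℤ (Set.range b) = Submodule.span ℤ s := by
  have hr := Real.finrank_eq_int_finrank_of_discrete hd
  unfold Set.finrank at hr
  let b₀ := Module.finBasisOfFinrankEq ℤ (Submodule.span ℤ s) (hm.trans hr).symm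
  have hs : Submodule.span ℤ (Set.range fun i => (b₀ i : Fin N → ℝ)) = Submodule.span ℤ s := by
    have := congrArg (Submodule.map (Submodule.subtype _)) b₀.span_eq
    rw [Submodule.map_span, ← Set.range_comp, Submodule.map_subtype_top] at this
    exact this
  refine ⟨fun i => b₀ i, ?_, hs⟩
  rw [linearIndependent_iff_card_eq_finrank_span, Set.finrank,
    ← Submodule.span_span_of_tower ℤ ℝ, hs, Submodule.span_span_of_tower]
  simpa using hm

lemma aux_indep {N m : ℕ} (s : Set (Fin N → ℝ))
    (hm : m = Module.finrank ℝ (Submodule.span ℝ s)) :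
    ∃ v : Fin m → Fin N → ℝ, (∀ i, v i ∈ s) ∧ LinearIndependent ℝ v := by
  subst hm
  obtain ⟨v, hvs, -, hvli⟩ := Submodule.exists_fun_fin_finrank_span_eq ℝ s
  exact ⟨v, hvs, hvli⟩

end AuxLemmas

theorem stmt10 (n : ℕ) (θ : Fin (n + 1) → ℝ) (hθ : ∀ i, 0 < θ i)
    (Γ : AddSubgroup (Fin (n + 1) → ℝ))
    (hdisc : ∃ ε > 0, ∀ x ∈ Γ, x ≠ 0 → ε ≤ ‖x‖)
    (ℓ : ℕ)
    (hℓ : ℓ = Module.finrank ℝ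
      (Submodule.span ℝ ((Γ : Set (Fin (n + 1) → ℝ)) ∩ PiBox θ)))
    (hpos : 0 < ℓ) :
    ((Γ : Set (Fin (n + 1) → ℝ)) ∩ PiBox θ).Finite ∧
    ((((Γ : Set (Fin (n + 1) → ℝ)) ∩ PiBox θ).ncard : ℝ) ≤
      cConst n *
        sSup {p : ℝ | ∃ I : Finset (Fin (n + 1)), I.card = ℓ ∧ p = ∏ i ∈ I, θ i} /
        (latDeltaR (Γ : Set (Fin (n + 1) → ℝ))) ^ ℓ + (n : ℝ) + 1) := by
  classical
  set s := (Γ : Set (Fin (n + 1) → ℝ)) ∩ PiBox θ with hs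
  have hΓd : DiscreteTopology Γ := aux_discrete Γ hdisc
  have hfin : s.Finite := by
    have hbd : Bornology.IsBounded (PiBox θ) := by
      refine (Metric.isBounded_closedBall (x := (0 : Fin (n + 1) → ℝ)) (r := ∑ i, θ i)).subset ?_
      intro x hx
      rw [mem_closedBall_zero_iff, pi_norm_le_iff_of_nonneg (Finset.sum_nonneg fun i _ => (hθ i).le)]
      intro i
      exact (hx i).le.trans (Finset.single_le_sum (fun i _ => (hθ i).le) (Finset.mem_univ i))
    rw [hs, Set.inter_comm]
    exact Metric.finite_isBounded_inter_isClosed DiscreteTopology.isDiscrete hbd inferInstance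
  refine ⟨hfin, ?_⟩
  have hspanΓ : ∀ x ∈ Submodule.span ℤ s, x ∈ Γ := by
    intro x hx
    have : Submodule.span ℤ s ≤ AddSubgroup.toIntSubmodule Γ :=
      Submodule.span_le.2 fun y hy => hy.1
    exact this hx
  have hd : DiscreteTopology (Submodule.span ℤ s) := by
    obtain ⟨ε, hε, h⟩ := hdisc
    exact aux_discrete (Submodule.span ℤ s).toAddSubgroup ⟨ε, hε, fun x hx => h x (hspanΓ x hx)⟩
  obtain ⟨b, hbli, hbs⟩ := aux_lattice s hd hℓ
  obtain ⟨v, hvs, hvli⟩ := aux_indep s hℓ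
  have hle : ℓ ≤ n + 1 := by
    simpa using hvli.fintype_card_le_finrank
  -- properties of δ
  set δ := latDeltaR (Γ : Set (Fin (n + 1) → ℝ)) with hδdef
  have hδle : ∀ a ∈ Γ, a ≠ 0 → δ ≤ ‖a‖ := by
    intro a ha ha0
    refine csInf_le ⟨0, ?_⟩ ⟨a, ha, ha0, rfl⟩
    rintro _ ⟨a, -, -, rfl⟩
    exact norm_nonneg a
  have hδ : 0 < δ := by
    obtain ⟨ε, hε, h⟩ := hdisc
    refine lt_of_lt_of_le hε (le_csInf ⟨_, v ⟨0, hpos⟩, (hvs _).1, hvli.ne_zero _, rfl⟩ ?_)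
    rintro _ ⟨a, ha, ha0, rfl⟩
    exact h a ha ha0
  -- Gram determinant
  let B : Matrix (Fin ℓ) (Fin (n + 1)) ℝ := b
  obtain ⟨hdpos, hgram⟩ := aux_gram hpos B hbli δ hδ (by
    intro z hz
    have e : (fun i => ∑ j, (z j : ℝ) * B j i) = ∑ j, (z j : ℝ) • b j := by
      ext i; simp [B]
    rw [e]
    refine hδle _ (hspanΓ _ ?_) ?_
    · rw [← hbs]
      refine Submodule.sum_mem _ fun j _ => ?_
      rw [Int.cast_smul_eq_zsmul]
      exact Submodule.smul_mem _ _ (Submodule.subset_span ⟨j, rfl⟩)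
    · intro h0
      apply hz
      ext j
      have := Fintype.linearIndependent_iff.1 hbli _ h0 j
      exact_mod_cast this)
  obtain ⟨f, hfinj, hfdet, hfle⟩ := aux_minor B hdpos
  set M := B.submatrix id f with hM
  have hMli : LinearIndependent ℝ M.row := Matrix.linearIndependent_rows_of_det_ne_zero hfdet
  -- projection
  let p : (Fin (n + 1) → ℝ) →ₗ[ℝ] (Fin ℓ → ℝ) := LinearMap.funLeft ℝ ℝ f
  have hpb : ∀ j, p (b j) = M j := fun j => rfl
  have hpinj : ∀ x ∈ Submodule.span ℝ (Set.range b), p x = 0 → x = 0 := by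
    intro x hx h0
    obtain ⟨t, rfl⟩ := (Submodule.mem_span_range_iff_exists_fun ℝ).1 hx
    simp only [map_sum, map_smul, hpb] at h0
    have := Fintype.linearIndependent_iff.1 hMli t h0
    simp [this]
  have hsZ : ∀ x ∈ s, x ∈ Submodule.span ℤ (Set.range b) := by
    intro x hx
    rw [hbs]
    exact Submodule.subset_span hx
  have hsR : ∀ x ∈ s, x ∈ Submodule.span ℝ (Set.range b) := fun x hx =>
    Submodule.span_subset_span ℤ ℝ _ (hsZ x hx)
  have hpZ : ∀ x ∈ s, p x ∈ Submodule.span ℤ (Set.range fun j => M j) := by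
    intro x hx
    obtain ⟨t, rfl⟩ := (Submodule.mem_span_range_iff_exists_fun ℤ).1 (hsZ x hx)
    rw [map_sum]
    refine Submodule.sum_mem _ fun j _ => ?_
    rw [map_zsmul, hpb]
    exact Submodule.smul_mem _ _ (Submodule.subset_span ⟨j, rfl⟩)
  have hpθ : ∀ x ∈ s, ∀ i, |p x i| < θ (f i) := fun x hx i => hx.2 (f i)
  have hcount := aux_count M hfdet (θ ∘ f) (fun i => hθ _) (fun k => p (v k))
    (hvli.map (by
      rw [Submodule.disjoint_def]
      intro x hx hx0
      refine hpinj x ?_ hx0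
      refine (Submodule.span_le.2 ?_) hx
      rintro _ ⟨k, rfl⟩
      exact hsR _ (hvs k)))
    (fun k => hpZ _ (hvs k)) (fun k => hpθ _ (hvs k)) (hfin.toFinset.image p)
    (by
      intro x hx
      obtain ⟨y, hy, rfl⟩ := Finset.mem_image.1 hx
      exact hpZ y (hfin.mem_toFinset.1 hy))
    (by
      intro x hx
      obtain ⟨y, hy, rfl⟩ := Finset.mem_image.1 hx
      exact hpθ y (hfin.mem_toFinset.1 hy))
  rw [Finset.card_image_of_injOn (by
    intro x hx y hy hxy
    have hx' := hsR x (hfin.mem_toFinset.1 hx)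
    have hy' := hsR y (hfin.mem_toFinset.1 hy)
    refine sub_eq_zero.1 (hpinj _ (Submodule.sub_mem _ hx' hy') ?_)
    rw [map_sub]
    exact sub_eq_zero.2 hxy), ← Set.ncard_eq_toFinset_card s hfin] at hcount
  -- the supremum
  set Θ := sSup {p : ℝ | ∃ I : Finset (Fin (n + 1)), I.card = ℓ ∧ p = ∏ i ∈ I, θ i} with hΘ
  have hΘle : ∏ i, (θ ∘ f) i ≤ Θ := by
    refine le_csSup ?_ ⟨Finset.univ.map ⟨f, hfinj⟩, by simp, by simp⟩
    refine (Set.Finite.subset (Set.finite_range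
      fun I : Finset (Fin (n + 1)) => ∏ i ∈ I, θ i) ?_).bddAbove
    rintro _ ⟨I, -, rfl⟩
    exact ⟨I, rfl⟩
  have hΘ0 : 0 ≤ Θ := (Finset.prod_nonneg fun i _ => (hθ (f i)).le).trans hΘle
  -- combine
  set C : ℝ := ((n + 1).choose ℓ : ℝ) with hC
  have hsq : √((B * B.transpose).det) ≤ √C * |M.det| := by
    rw [← Real.sqrt_sq_eq_abs, ← Real.sqrt_mul (by positivity)]
    exact Real.sqrt_le_sqrt hfle
  have hlow := hgram.trans hsq
  have hl0 : (0 : ℝ) < √ℓ := Real.sqrt_pos.2 (by exact_mod_cast hpos)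
  rw [div_pow, div_le_iff₀ (by positivity)] at hlow
  have hmain : (s.ncard : ℝ) * δ ^ ℓ ≤ cConst n * Θ := by
    calc (s.ncard : ℝ) * δ ^ ℓ ≤ s.ncard * (√C * |M.det| * √ℓ ^ ℓ) := by gcongr
      _ = (s.ncard * |M.det|) * (√C * √ℓ ^ ℓ) := by ring
      _ ≤ ((ℓ + 2 : ℝ) ^ ℓ * ∏ i, (θ ∘ f) i) * (√C * √ℓ ^ ℓ) := by gcongr
      _ ≤ ((ℓ + 2 : ℝ) ^ ℓ * Θ) * (√C * √ℓ ^ ℓ) := by gcongr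
      _ = ((ℓ + 2 : ℝ) ^ ℓ * √C * √ℓ ^ ℓ) * Θ := by ring
      _ ≤ cConst n * Θ := by
        gcongr
        exact aux_const n ℓ hle
  have hfinal := (le_div_iff₀ (by positivity)).2 hmain
  have : (0 : ℝ) ≤ n := Nat.cast_nonneg n
  linarith
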